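/- Suppose Assumption A holds, let λ* ∈ S_λ satisfy λ*_i > 0 for all i ∈ B₊, and let σ₀, ρ₀, σ₁, γ, β̄ be the constants from the sSQP local convergence result (Corollary 5.1). Let σ ∈ (0,1). Then there is ρ₂ ∈ (0, ρ₀] such that whenever ‖(z⁰,λ⁰) − (z*,λ*)‖ ≤ ρ₂, the sequence generated by the sSQP iteration with stabilization parameter μ_k = η(z^k,λ^k)^σ at every iteration k satisfies μ_k ∈ [σ₀‖z^k − z*‖, σ₁] for all k; consequently the conclusions of Corollary 5.1 hold with this particular choice of μ_k. -/

import Mathlib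

open scoped RealInnerProductSpace
open Metric Set

noncomputable section

/-- Euclidean space ℝ^n. -/
abbrev En (n : ℕ) := EuclideanSpace ℝ (Fin n)

/-- The Lagrangian L(z,λ) = φ(z) + λᵀ g(z). -/
def Lagr {n m : ℕ} (φ : En n → ℝ) (g : Fin m → En n → ℝ) (z : En n) (l : En m) : ℝ :=
  φ z + ∑ i, l i * g i z

/-- ∇_z L(z,λ). -/
def gradL {n m : ℕ} (φ : En n → ℝ) (g : Fin m → En n → ℝ) (l : En m) (z : En n) : En n :=
  gradient (fun z' => Lagr φ g z' l) z

/-- ∇²_{zz} L(z,λ), as a continuous linear map. -/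
def hessL {n m : ℕ} (φ : En n → ℝ) (g : Fin m → En n → ℝ) (l : En m) (z : En n) :
    En n →L[ℝ] En n :=
  fderiv ℝ (gradL φ g l) z

/-- The KKT conditions at a point z with multiplier λ. -/
def KKTat {n m : ℕ} (φ : En n → ℝ) (g : Fin m → En n → ℝ) (z : En n) (l : En m) : Prop :=
  gradL φ g l z = 0 ∧ (∀ i, g i z ≤ 0) ∧ (∀ i, 0 ≤ l i) ∧ ∑ i, l i * g i z = 0

/-- The set S_λ of optimal multipliers at z*. -/
def Slam {n m : ℕ} (φ : En n → ℝ) (g : Fin m → En n → ℝ) (zs : En n) : Set (En m) :=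
  {l | KKTat φ g zs l}

/-- The active set B. -/
def ActB {n m : ℕ} (g : Fin m → En n → ℝ) (zs : En n) : Set (Fin m) := {i | g i zs = 0}

/-- Strongly active constraints B₊. -/
def Bplus {n m : ℕ} (φ : En n → ℝ) (g : Fin m → En n → ℝ) (zs : En n) : Set (Fin m) :=
  {i | g i zs = 0 ∧ ∃ l ∈ Slam φ g zs, 0 < l i}

/-- Weakly active constraints B₀ = B \ B₊. -/
def Bzero {n m : ℕ} (φ : En n → ℝ) (g : Fin m → En n → ℝ) (zs : En n) : Set (Fin m) :=
  ActB g zs \ Bplus φ g zs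

/-- Mangasarian–Fromovitz constraint qualification at z*. -/
def MFCQ {n m : ℕ} (g : Fin m → En n → ℝ) (zs : En n) : Prop :=
  ∃ y : En n, ∀ i ∈ ActB g zs, ⟪gradient (g i) zs, y⟫ < 0

/-- The second-order sufficient condition. -/
def SOC {n m : ℕ} (φ : En n → ℝ) (g : Fin m → En n → ℝ) (zs : En n) : Prop :=
  ∃ σ : ℝ, 0 < σ ∧ ∀ l ∈ Slam φ g zs, ∀ w : En n,
    (∀ i ∈ Bplus φ g zs, ⟪gradient (g i) zs, w⟫ = 0) →
    (∀ i ∈ Bzero φ g zs, ⟪gradient (g i) zs, w⟫ ≤ 0) →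
    σ * ‖w‖ ^ 2 ≤ ⟪w, hessL φ g l zs w⟫

/-- φ and g twice Lipschitz continuously differentiable near z*. -/
def Smooth2 {n m : ℕ} (φ : En n → ℝ) (g : Fin m → En n → ℝ) (zs : En n) : Prop :=
  ∃ U ∈ nhds zs, ContDiffOn ℝ 2 φ U ∧ (∀ i, ContDiffOn ℝ 2 (g i) U) ∧
    ∃ K : NNReal, LipschitzOnWith K (fun z => fderiv ℝ (fderiv ℝ φ) z) U ∧
      ∀ i, LipschitzOnWith K (fun z => fderiv ℝ (fderiv ℝ (g i)) z) U

/-- Assumption A: smoothness, KKT, MFCQ and the second-order condition hold at z*. -/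
def AssumpA {n m : ℕ} (φ : En n → ℝ) (g : Fin m → En n → ℝ) (zs : En n) : Prop :=
  Smooth2 φ g zs ∧ (∃ l : En m, KKTat φ g zs l) ∧ MFCQ g zs ∧ SOC φ g zs

/-- δ(z,λ) = dist((z,λ), S) where S = {z*} × S_λ (Euclidean product norm). -/
def deltaP {n m : ℕ} (φ : En n → ℝ) (g : Fin m → En n → ℝ) (zs : En n)
    (z : En n) (l : En m) : ℝ :=
  Real.sqrt (‖z - zs‖ ^ 2 + (Metric.infDist l (Slam φ g zs)) ^ 2)

/-- η(z,λ) = ‖(∇_z L(z,λ), min(λ, −g(z)))‖. -/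
def eta {n m : ℕ} (φ : En n → ℝ) (g : Fin m → En n → ℝ) (z : En n) (l : En m) : ℝ :=
  Real.sqrt (‖gradL φ g l z‖ ^ 2 + ∑ i, (min (l i) (-(g i z))) ^ 2)

/-- The estimated active set A(z,λ) = {i : g_i(z) ≥ −η(z,λ)^τ}. -/
def Aest {n m : ℕ} (φ : En n → ℝ) (g : Fin m → En n → ℝ) (τ : ℝ) (z : En n) (l : En m) :
    Set (Fin m) :=
  {i | -(eta φ g z l) ^ τ ≤ g i z}

/-- Feasibility for the linear program LP(Â) (independent of Â): componentwise bounds on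
∇φ(z) + Σ_i λ̃_i ∇g_i(z), nonnegativity on A(z,λ), and λ̃_i = 0 off A(z,λ). -/
def LPFeasible {n m : ℕ} (φ : En n → ℝ) (g : Fin m → En n → ℝ) (τ : ℝ)
    (z : En n) (l : En m) (lt : En m) : Prop :=
  (∀ j : Fin n, |(gradient φ z + ∑ i, lt i • gradient (g i) z) j| ≤ (eta φ g z l) ^ τ) ∧
  (∀ i ∈ Aest φ g τ z l, 0 ≤ lt i) ∧ (∀ i ∉ Aest φ g τ z l, lt i = 0)

/-- The objective Σ_{i ∈ Â} λ̃_i of LP(Â). -/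
def lpObj {m : ℕ} (Ah : Set (Fin m)) (lt : En m) : ℝ :=
  ∑ i, Ah.indicator (fun i => lt i) i

/-- λ̃ is an optimal solution of LP(Â). -/
def LPOptimal {n m : ℕ} (φ : En n → ℝ) (g : Fin m → En n → ℝ) (τ : ℝ)
    (z : En n) (l : En m) (Ah : Set (Fin m)) (lt : En m) : Prop :=
  LPFeasible φ g τ z l lt ∧ ∀ lt', LPFeasible φ g τ z l lt' → lpObj Ah lt' ≤ lpObj Ah lt

/-- The initial working set Â_init of Procedure ID0. -/
def initSet {n m : ℕ} (φ : En n → ℝ) (g : Fin m → En n → ℝ) (τ th : ℝ)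
    (z : En n) (l : En m) : Set (Fin m) :=
  Aest φ g τ z l \ {i | (eta φ g z l) ^ th ≤ l i}

/-- One pass of the repeat loop of Procedure ID0 that does not stop:
an optimal solution λ̃ of LP(Â) is chosen, C = {i ∈ Â : λ̃_i ≥ η^τ̂} is nonempty,
and the working set is updated to Â \ C. -/
def ID0Step {n m : ℕ} (φ : En n → ℝ) (g : Fin m → En n → ℝ) (τ th : ℝ)
    (z : En n) (l : En m) (Ah Ah' : Set (Fin m)) : Prop :=
  ∃ lt, LPOptimal φ g τ z l Ah lt ∧
    {i | i ∈ Ah ∧ (eta φ g z l) ^ th ≤ lt i} ≠ ∅ ∧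
    Ah' = Ah \ {i | i ∈ Ah ∧ (eta φ g z l) ^ th ≤ lt i}

/-- (A₀, A₊) is a possible output of Procedure ID0 on input (z,λ). -/
def ID0Out {n m : ℕ} (φ : En n → ℝ) (g : Fin m → En n → ℝ) (τ th : ℝ)
    (z : En n) (l : En m) (A0 Ap : Set (Fin m)) : Prop :=
  ∃ Ah : Set (Fin m),
    Relation.ReflTransGen (ID0Step φ g τ th z l) (initSet φ g τ th z l) Ah ∧
    ((∃ lt, LPOptimal φ g τ z l Ah lt ∧
        {i | i ∈ Ah ∧ (eta φ g z l) ^ th ≤ lt i} = ∅ ∧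
        A0 = Ah ∧ Ap = Aest φ g τ z l \ Ah) ∨
     (∃ lt, LPOptimal φ g τ z l Ah lt ∧
        {i | i ∈ Ah ∧ (eta φ g z l) ^ th ≤ lt i} ≠ ∅ ∧
        Ah \ {i | i ∈ Ah ∧ (eta φ g z l) ^ th ≤ lt i} = ∅ ∧
        A0 = ∅ ∧ Ap = Aest φ g τ z l))

/-- Feasibility for the linear program (intlam). -/
def IntFeasible {n m : ℕ} (φ : En n → ℝ) (g : Fin m → En n → ℝ) (τ : ℝ)
    (z : En n) (l : En m) (Ap : Set (Fin m)) (t : ℝ) (lh : En m) : Prop :=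
  (∀ i ∈ Ap, t ≤ lh i) ∧
  (∀ j : Fin n, |(gradient φ z + ∑ i, lh i • gradient (g i) z) j| ≤ (eta φ g z l) ^ τ) ∧
  (∀ i ∈ Ap, 0 ≤ lh i) ∧ (∀ i ∉ Ap, lh i = 0)

/-- (t̂, λ̂) is an optimal solution of (intlam). -/
def IntOptimal {n m : ℕ} (φ : En n → ℝ) (g : Fin m → En n → ℝ) (τ : ℝ)
    (z : En n) (l : En m) (Ap : Set (Fin m)) (t : ℝ) (lh : En m) : Prop :=
  IntFeasible φ g τ z l Ap t lh ∧
  ∀ t' lh', IntFeasible φ g τ z l Ap t' lh' → t' ≤ t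

/-- ε_λ = max_{λ* ∈ S_λ} min_{i ∈ B₊} λ*_i. -/
def epsLam {n m : ℕ} (φ : En n → ℝ) (g : Fin m → En n → ℝ) (zs : En n) : ℝ :=
  ⨆ l ∈ Slam φ g zs, ⨅ i ∈ Bplus φ g zs, l i

/-- S_λ^ν = {λ ∈ S_λ : min_{i∈B₊} λ_i ≥ ν ε_λ}. -/
def SlamNu {n m : ℕ} (φ : En n → ℝ) (g : Fin m → En n → ℝ) (zs : En n) (ν : ℝ) :
    Set (En m) :=
  {l ∈ Slam φ g zs | ∀ i ∈ Bplus φ g zs, ν * epsLam φ g zs ≤ l i}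

/-- (Δz, λ⁺) solves the stabilized SQP subproblem at (z,λ) with parameter μ. -/
def SSQPSol {n m : ℕ} (φ : En n → ℝ) (g : Fin m → En n → ℝ)
    (z : En n) (l : En m) (μ : ℝ) (dz : En n) (lp : En m) : Prop :=
  hessL φ g l z dz + gradient φ z + ∑ i, lp i • gradient (g i) z = 0 ∧
  (∀ i, 0 ≤ lp i) ∧
  (∀ i, g i z + ⟪gradient (g i) z, dz⟫ - μ * (lp i - l i) ≤ 0) ∧
  ∑ i, lp i * (g i z + ⟪gradient (g i) z, dz⟫ - μ * (lp i - l i)) = 0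

/-- Euclidean distance between primal-dual pairs. -/
def pdist {n m : ℕ} (p q : En n × En m) : ℝ :=
  Real.sqrt (‖p.1 - q.1‖ ^ 2 + ‖p.2 - q.2‖ ^ 2)

lemma gradient_differentiableAt {n : ℕ} {f : En n → ℝ} {z : En n} (hf : ContDiffAt ℝ 2 f z) :
    DifferentiableAt ℝ (gradient f) z := by
  have h : DifferentiableAt ℝ (fderiv ℝ f) z :=
    (hf.fderiv_right (m := 1) (by norm_num)).differentiableAt one_ne_zero
  exact (InnerProductSpace.toDual ℝ (En n)).symm.toContinuousLinearEquiv.differentiableAt.comp z h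

lemma gradL_eq {n m : ℕ} {φ : En n → ℝ} {g : Fin m → En n → ℝ} {z : En n} (l : En m)
    (hφ : DifferentiableAt ℝ φ z) (hg : ∀ i, DifferentiableAt ℝ (g i) z) :
    gradL φ g l z = gradient φ z + ∑ i, l i • gradient (g i) z := by
  have h : HasFDerivAt (fun z' => Lagr φ g z' l)
      (fderiv ℝ φ z + ∑ i, l i • fderiv ℝ (g i) z) z :=
    hφ.hasFDerivAt.add (HasFDerivAt.fun_sum fun i _ => (hg i).hasFDerivAt.const_mul (l i))
  simp only [gradL, gradient, h.fderiv, map_add, map_sum, map_smulₛₗ]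
  simp

lemma gradL_eventually_eq {n m : ℕ} {φ : En n → ℝ} {g : Fin m → En n → ℝ} {zs : En n}
    (hφ : ContDiffAt ℝ 2 φ zs) (hg : ∀ i, ContDiffAt ℝ 2 (g i) zs) :
    ∀ᶠ z in nhds zs, ∀ l : En m,
      gradL φ g l z = gradient φ z + ∑ i, l i • gradient (g i) z := by
  have hg' : ∀ᶠ z in nhds zs, ∀ i, ContDiffAt ℝ 2 (g i) z :=
    Filter.eventually_all.2 fun i => (hg i).eventually (by simp)
  filter_upwards [hφ.eventually (by simp), hg'] with z h1 h2 l
  exact gradL_eq l (h1.differentiableAt two_ne_zero) fun i => (h2 i).differentiableAt two_ne_zero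

lemma hessL_eq {n m : ℕ} {φ : En n → ℝ} {g : Fin m → En n → ℝ} {zs : En n} (l : En m)
    (hφ : ContDiffAt ℝ 2 φ zs) (hg : ∀ i, ContDiffAt ℝ 2 (g i) zs) :
    hessL φ g l zs =
      fderiv ℝ (gradient φ) zs + ∑ i, l i • fderiv ℝ (gradient (g i)) zs := by
  have h : HasFDerivAt (fun z => gradient φ z + ∑ i, l i • gradient (g i) z)
      (fderiv ℝ (gradient φ) zs + ∑ i, l i • fderiv ℝ (gradient (g i)) zs) zs :=
    (gradient_differentiableAt hφ).hasFDerivAt.add (HasFDerivAt.fun_sum fun i _ =>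
      (gradient_differentiableAt (hg i)).hasFDerivAt.const_smul (l i))
  exact (h.congr_of_eventuallyEq
    ((gradL_eventually_eq hφ hg).mono fun z hz => hz l)).fderiv

lemma Smooth2.contDiffAt {n m : ℕ} {φ : En n → ℝ} {g : Fin m → En n → ℝ} {zs : En n}
    (h : Smooth2 φ g zs) : ContDiffAt ℝ 2 φ zs ∧ ∀ i, ContDiffAt ℝ 2 (g i) zs := by
  obtain ⟨U, hU, h1, h2, -⟩ := h
  exact ⟨h1.contDiffAt hU, fun i => (h2 i).contDiffAt hU⟩

lemma norm_gradL_le_eta {n m : ℕ} (φ : En n → ℝ) (g : Fin m → En n → ℝ) (z : En n) (l : En m) :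
    ‖gradL φ g l z‖ ≤ eta φ g z l :=
  Real.le_sqrt_of_sq_le (le_add_of_nonneg_right (Finset.sum_nonneg fun _ _ => sq_nonneg _))

lemma abs_min_le_eta {n m : ℕ} (φ : En n → ℝ) (g : Fin m → En n → ℝ) (z : En n) (l : En m)
    (i : Fin m) : |min (l i) (-(g i z))| ≤ eta φ g z l := by
  refine Real.le_sqrt_of_sq_le ?_
  rw [sq_abs]
  have := Finset.single_le_sum (f := fun i => (min (l i) (-(g i z))) ^ 2)
    (fun _ _ => sq_nonneg _) (Finset.mem_univ i)
  nlinarith [sq_nonneg ‖gradL φ g l z‖]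

lemma eta_nonneg {n m : ℕ} (φ : En n → ℝ) (g : Fin m → En n → ℝ) (z : En n) (l : En m) :
    0 ≤ eta φ g z l := Real.sqrt_nonneg _

/-- A multiplier is bounded by the residual as soon as its constraint is slack beyond it. -/
lemma abs_le_eta_of_lt {n m : ℕ} {φ : En n → ℝ} {g : Fin m → En n → ℝ} {z : En n} {l : En m}
    {i : Fin m} (h : eta φ g z l < -(g i z)) : |l i| ≤ eta φ g z l := by
  have h1 := abs_min_le_eta φ g z l i
  rcases le_total (l i) (-(g i z)) with h2 | h2
  · rwa [min_eq_left h2] at h1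
  · rw [min_eq_right h2] at h1
    exact absurd ((le_abs_self _).trans h1) h.not_ge

lemma KKTat.mul_eq_zero {n m : ℕ} {φ : En n → ℝ} {g : Fin m → En n → ℝ} {z : En n} {l : En m}
    (h : KKTat φ g z l) (i : Fin m) : l i * g i z = 0 :=
  (Finset.sum_eq_zero_iff_of_nonpos fun j _ =>
    mul_nonpos_of_nonneg_of_nonpos (h.2.2.1 j) (h.2.1 j)).1 h.2.2.2 i (Finset.mem_univ i)

lemma tendsto_eta {n m : ℕ} {φ : En n → ℝ} {g : Fin m → En n → ℝ} {zs : En n} {ls : En m}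
    (hφ : ContDiffAt ℝ 2 φ zs) (hg : ∀ i, ContDiffAt ℝ 2 (g i) zs) (hls : KKTat φ g zs ls) :
    Filter.Tendsto (fun p : En n × En m => eta φ g p.1 p.2) (nhds (zs, ls)) (nhds 0) := by
  have hfst : Filter.Tendsto (fun p : En n × En m => p.1) (nhds (zs, ls)) (nhds zs) :=
    continuous_fst.tendsto _
  have hl : ∀ i, Filter.Tendsto (fun p : En n × En m => p.2 i) (nhds (zs, ls)) (nhds (ls i)) :=
    fun i => Continuous.tendsto (by fun_prop) (zs, ls)
  have hgc : ∀ i, Filter.Tendsto (fun p : En n × En m => g i p.1) (nhds (zs, ls))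
      (nhds (g i zs)) := fun i => (hg i).continuousAt.tendsto.comp hfst
  have hG : Filter.Tendsto (fun p : En n × En m => gradL φ g p.2 p.1) (nhds (zs, ls))
      (nhds (gradL φ g ls zs)) := by
    rw [(gradL_eventually_eq hφ hg).self_of_nhds ls]
    refine Filter.Tendsto.congr' ((hfst.eventually (gradL_eventually_eq hφ hg)).mono
      fun p hp => (hp p.2).symm) ?_
    exact ((gradient_differentiableAt hφ).continuousAt.tendsto.comp hfst).add
      (tendsto_finsetSum _ fun i _ => (hl i).smul
        ((gradient_differentiableAt (hg i)).continuousAt.tendsto.comp hfst))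
  have h := ((hG.norm.pow 2).add (tendsto_finsetSum Finset.univ fun i _ =>
    ((hl i).min (hgc i).neg).pow 2)).sqrt
  have hmin : ∀ i, min (ls i) (-(g i zs)) = 0 := fun i => by
    rcases mul_eq_zero.1 (hls.mul_eq_zero i) with h0 | h0
    · rw [h0, min_eq_left]; linarith [hls.2.1 i]
    · rw [h0, neg_zero, min_eq_right (hls.2.2.1 i)]
  simpa [hmin, hls.1, eta] using h

/-- A sequence approaching a KKT pair with positive strong multipliers cannot have a residual
that is negligible compared with its primal distance, under the second-order condition. -/
lemma not_eta_isLittleO {n m : ℕ} {φ : En n → ℝ} {g : Fin m → En n → ℝ} {zs : En n} {ls : En m}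
    (hφ : ContDiffAt ℝ 2 φ zs) (hg : ∀ i, ContDiffAt ℝ 2 (g i) zs) (hsoc : SOC φ g zs)
    (hls : KKTat φ g zs ls) (hpos : ∀ i ∈ Bplus φ g zs, 0 < ls i)
    {x : ℕ → En n} {l : ℕ → En m} {d : En n}
    (hx : Filter.Tendsto x Filter.atTop (nhds zs)) (hl : Filter.Tendsto l Filter.atTop (nhds ls))
    (ht : ∀ k, 0 < ‖x k - zs‖)
    (hd : Filter.Tendsto (fun k => ‖x k - zs‖⁻¹ • (x k - zs)) Filter.atTop (nhds d))
    (heta : Filter.Tendsto (fun k => ‖x k - zs‖⁻¹ * eta φ g (x k) (l k)) Filter.atTop (nhds 0)) :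
    False := by
  have hd1 : ‖d‖ = 1 := by
    refine tendsto_nhds_unique hd.norm (tendsto_const_nhds.congr fun k => ?_)
    rw [norm_smul, norm_inv, norm_norm, inv_mul_cancel₀ (ht k).ne']
  have heta0 := (tendsto_eta hφ hg hls).comp (hx.prodMk_nhds hl)
  have hli : ∀ i, Filter.Tendsto (fun k => l k i) Filter.atTop (nhds (ls i)) := fun i =>
    ((Continuous.tendsto (f := fun v : En m => v i) (by fun_prop) ls).comp hl)
  have hgx : ∀ i, Filter.Tendsto (fun k => g i (x k)) Filter.atTop (nhds (g i zs)) :=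
    fun i => (hg i).continuousAt.tendsto.comp hx
  have hquot : ∀ {F : Type} [NormedAddCommGroup F] [NormedSpace ℝ F] {f : En n → F}
      (_ : DifferentiableAt ℝ f zs), Filter.Tendsto
        (fun k => ‖x k - zs‖⁻¹ • (f (x k) - f zs)) Filter.atTop (nhds (fderiv ℝ f zs d)) := by
    intro F _ _ f hf
    simpa using hf.hasFDerivAt.hasFDerivWithinAt.lim (s := univ) (d := fun k => x k - zs)
      (by simpa using hx.sub_const zs) (Filter.Eventually.of_forall fun _ => mem_univ _) hd
  have hgq : ∀ i, Filter.Tendsto (fun k => ‖x k - zs‖⁻¹ * (g i (x k) - g i zs)) Filter.atTop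
      (nhds ⟪gradient (g i) zs, d⟫) := fun i => by
    simpa [gradient] using hquot ((hg i).differentiableAt two_ne_zero)
  -- a slack constraint has a multiplier that is negligible in the primal distance
  have hslack : ∀ i, ls i = 0 → (∀ᶠ k in Filter.atTop, eta φ g (x k) (l k) < -(g i (x k))) →
      Filter.Tendsto (fun k => ‖x k - zs‖⁻¹ * (l k i - ls i)) Filter.atTop (nhds 0) := by
    intro i h0 hev
    refine squeeze_zero_norm' (hev.mono fun k hk => ?_) heta
    rw [h0, sub_zero, norm_mul, norm_inv, norm_norm]
    exact mul_le_mul_of_nonneg_left (abs_le_eta_of_lt hk) (inv_nonneg.2 (norm_nonneg _))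
  have hplus : ∀ i ∈ Bplus φ g zs, ⟪gradient (g i) zs, d⟫ = 0 := by
    intro i hi
    refine tendsto_nhds_unique (hgq i) (squeeze_zero_norm' ?_ heta)
    have hev : ∀ᶠ k in Filter.atTop, -(g i (x k)) < l k i :=
      (hgx i).neg.eventually_lt (hli i) (by rw [hi.1, neg_zero]; exact hpos i hi)
    filter_upwards [hev] with k hk
    have h1 := abs_min_le_eta φ g (x k) (l k) i
    rw [min_eq_right hk.le, abs_neg] at h1
    rw [hi.1, sub_zero, norm_mul, norm_inv, norm_norm]
    exact mul_le_mul_of_nonneg_left h1 (inv_nonneg.2 (norm_nonneg _))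
  have hzero : ∀ i ∈ Bzero φ g zs, ⟪gradient (g i) zs, d⟫ ≤ 0 := by
    intro i hi
    have hi0 : g i zs = 0 := hi.1
    refine le_of_tendsto_of_tendsto' (hgq i) heta fun k => ?_
    refine mul_le_mul_of_nonneg_left ?_ (inv_nonneg.2 (norm_nonneg _))
    have h1 := (abs_le.1 (abs_min_le_eta φ g (x k) (l k) i)).1
    rw [hi0]
    linarith [min_le_right (l k i) (-(g i (x k)))]
  have hprod : ∀ i, Filter.Tendsto
      (fun k => (‖x k - zs‖⁻¹ * (l k i - ls i)) * ⟪gradient (g i) zs, d⟫) Filter.atTop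
      (nhds 0) := by
    intro i
    by_cases hd0 : ⟪gradient (g i) zs, d⟫ = 0
    · simp [hd0]
    have hiB : i ∉ Bplus φ g zs := fun hi => hd0 (hplus i hi)
    rw [← zero_mul ⟪gradient (g i) zs, d⟫]
    refine Filter.Tendsto.mul_const _ ?_
    by_cases hact : g i zs = 0
    · have h0 : ls i = 0 := le_antisymm
        (not_lt.1 fun h => hiB ⟨hact, ls, hls, h⟩) (hls.2.2.1 i)
      refine hslack i h0 ?_
      have hneg : ⟪gradient (g i) zs, d⟫ < 0 := lt_of_le_of_ne (hzero i ⟨hact, hiB⟩) hd0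
      filter_upwards [heta.eventually_lt (hgq i).neg (by linarith)] with k hk
      rw [hact, sub_zero, ← mul_neg] at hk
      exact lt_of_mul_lt_mul_left hk (inv_nonneg.2 (norm_nonneg _))
    · have h0 : ls i = 0 := (mul_eq_zero.1 (hls.mul_eq_zero i)).resolve_right hact
      exact hslack i h0 (heta0.eventually_lt (hgx i).neg
        (neg_pos.2 (lt_of_le_of_ne (hls.2.1 i) hact)))
  have hgrad : Filter.Tendsto (fun k => ‖x k - zs‖⁻¹ • gradL φ g (l k) (x k)) Filter.atTop
      (nhds 0) := by
    refine squeeze_zero_norm (fun k => ?_) heta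
    rw [norm_smul, norm_inv, norm_norm]
    exact mul_le_mul_of_nonneg_left (norm_gradL_le_eta ..) (inv_nonneg.2 (norm_nonneg _))
  have hH : Filter.Tendsto (fun k => ‖x k - zs‖⁻¹ • (gradient φ (x k) - gradient φ zs) +
      ∑ i, l k i • ‖x k - zs‖⁻¹ • (gradient (g i) (x k) - gradient (g i) zs)) Filter.atTop
      (nhds (hessL φ g ls zs d)) := by
    rw [hessL_eq ls hφ hg]
    simpa using (hquot (gradient_differentiableAt hφ)).add
      (tendsto_finsetSum Finset.univ fun i _ =>
        (hli i).smul (hquot (gradient_differentiableAt (hg i))))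
  have hstat : gradient φ zs + ∑ i, ls i • gradient (g i) zs = 0 :=
    ((gradL_eventually_eq hφ hg).self_of_nhds ls).symm.trans hls.1
  have hinner : Filter.Tendsto (fun k => ∑ i, (‖x k - zs‖⁻¹ * (l k i - ls i)) *
      ⟪gradient (g i) zs, d⟫) Filter.atTop (nhds ⟪0 - hessL φ g ls zs d, d⟫) := by
    refine ((hgrad.sub hH).inner tendsto_const_nhds).congr' ?_
    filter_upwards [hx.eventually (gradL_eventually_eq hφ hg)] with k hk
    have hφs : gradient φ zs = -∑ i, ls i • gradient (g i) zs := eq_neg_of_add_eq_zero_left hstat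
    have hsplit : ‖x k - zs‖⁻¹ • gradL φ g (l k) (x k) -
        (‖x k - zs‖⁻¹ • (gradient φ (x k) - gradient φ zs) +
          ∑ i, l k i • ‖x k - zs‖⁻¹ • (gradient (g i) (x k) - gradient (g i) zs)) =
        ∑ i, (‖x k - zs‖⁻¹ * (l k i - ls i)) • gradient (g i) zs := by
      rw [hk (l k), hφs, smul_add, smul_sub, smul_neg, Finset.smul_sum, Finset.smul_sum,
        add_sub_add_comm]
      simp only [← Finset.sum_neg_distrib, ← Finset.sum_sub_distrib]
      rw [sub_sub_cancel, ← Finset.sum_add_distrib]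
      exact Finset.sum_congr rfl fun i _ => by module
    rw [hsplit, sum_inner]
    simp only [real_inner_smul_left]
  have hHd : ⟪d, hessL φ g ls zs d⟫ = 0 := by
    have h := tendsto_nhds_unique hinner (tendsto_finsetSum Finset.univ fun i _ => hprod i)
    rw [zero_sub, inner_neg_left, Finset.sum_const_zero, real_inner_comm] at h
    exact neg_eq_zero.1 h
  obtain ⟨s, hs, hsd⟩ := hsoc
  have := hsd ls hls d hplus hzero
  rw [hHd, hd1] at this
  linarith

/-- Local error bound: the primal distance is controlled by the residual. -/
lemma exists_norm_sub_le_eta {n m : ℕ} {φ : En n → ℝ} {g : Fin m → En n → ℝ} {zs : En n}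
    {ls : En m} (hφ : ContDiffAt ℝ 2 φ zs) (hg : ∀ i, ContDiffAt ℝ 2 (g i) zs)
    (hsoc : SOC φ g zs) (hls : KKTat φ g zs ls) (hpos : ∀ i ∈ Bplus φ g zs, 0 < ls i) :
    ∃ C : ℝ, 0 < C ∧ ∀ᶠ p : En n × En m in nhds (zs, ls),
      ‖p.1 - zs‖ ≤ C * eta φ g p.1 p.2 := by
  by_contra! hcon
  have hk : ∀ k : ℕ, ∃ p : En n × En m, dist p (zs, ls) < 1 / ((k : ℝ) + 1) ∧
      ((k : ℝ) + 1) * eta φ g p.1 p.2 < ‖p.1 - zs‖ := fun k => by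
    have h := hcon ((k : ℝ) + 1) (by positivity)
    obtain ⟨p, hp, hp'⟩ := (h.and_eventually
      (Metric.ball_mem_nhds (zs, ls) (Nat.one_div_pos_of_nat (α := ℝ) (n := k)))).exists
    exact ⟨p, hp', hp⟩
  choose p hpd hpe using hk
  have hp : Filter.Tendsto p Filter.atTop (nhds (zs, ls)) :=
    tendsto_iff_dist_tendsto_zero.2 (squeeze_zero (fun _ => dist_nonneg) (fun k => (hpd k).le)
      tendsto_one_div_add_atTop_nhds_zero_nat)
  have ht : ∀ k, 0 < ‖(p k).1 - zs‖ := fun k =>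
    (mul_nonneg (by positivity) (eta_nonneg ..)).trans_lt (hpe k)
  have heta : Filter.Tendsto (fun k => ‖(p k).1 - zs‖⁻¹ * eta φ g (p k).1 (p k).2)
      Filter.atTop (nhds 0) := by
    refine squeeze_zero (fun k => mul_nonneg (inv_nonneg.2 (norm_nonneg _)) (eta_nonneg ..))
      (fun k => ?_) tendsto_one_div_add_atTop_nhds_zero_nat
    rw [inv_mul_eq_div, div_le_div_iff₀ (ht k) (by positivity)]
    linarith [hpe k]
  obtain ⟨d, -, ψ, hψ, hd⟩ := (isCompact_sphere (0 : En n) 1).tendsto_subseq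
    (x := fun k => ‖(p k).1 - zs‖⁻¹ • ((p k).1 - zs)) fun k => by
      rw [mem_sphere_zero_iff_norm, norm_smul, norm_inv, norm_norm, inv_mul_cancel₀ (ht k).ne']
  have hpψ := hp.comp hψ.tendsto_atTop
  exact not_eta_isLittleO hφ hg hsoc hls hpos (x := fun k => (p (ψ k)).1)
    (l := fun k => (p (ψ k)).2) ((continuous_fst.tendsto _).comp hpψ)
    ((continuous_snd.tendsto _).comp hpψ) (fun k => ht _) hd (heta.comp hψ.tendsto_atTop)

/-- Near the reference KKT pair, the stabilization parameter `eta ^ σ` dominates any multiple of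
the primal distance and is below any positive bound. -/
lemma eventually_eta_rpow_bounds {n m : ℕ} {φ : En n → ℝ} {g : Fin m → En n → ℝ} {zs : En n}
    {ls : En m} (hφ : ContDiffAt ℝ 2 φ zs) (hg : ∀ i, ContDiffAt ℝ 2 (g i) zs)
    (hsoc : SOC φ g zs) (hls : KKTat φ g zs ls) (hpos : ∀ i ∈ Bplus φ g zs, 0 < ls i)
    {σ₀ σ₁ σ : ℝ} (hσ₀ : 0 < σ₀) (hσ₁ : 0 < σ₁) (hσ0 : 0 < σ) (hσ1 : σ < 1) :
    ∀ᶠ p : En n × En m in nhds (zs, ls),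
      σ₀ * ‖p.1 - zs‖ ≤ (eta φ g p.1 p.2) ^ σ ∧ (eta φ g p.1 p.2) ^ σ ≤ σ₁ := by
  obtain ⟨C, hC, hCe⟩ := exists_norm_sub_le_eta hφ hg hsoc hls hpos
  have hup : Filter.Tendsto (fun p : En n × En m => (eta φ g p.1 p.2) ^ σ) (nhds (zs, ls))
      (nhds 0) := by
    simpa [Real.zero_rpow hσ0.ne'] using
      (tendsto_eta hφ hg hls).rpow_const (p := σ) (Or.inr hσ0.le)
  have hnorm : Filter.Tendsto (fun p : En n × En m => ‖p.1 - zs‖) (nhds (zs, ls)) (nhds 0) := by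
    have h : Continuous fun p : En n × En m => ‖p.1 - zs‖ := by fun_prop
    simpa using h.tendsto (zs, ls)
  have hlow : Filter.Tendsto (fun p : En n × En m => σ₀ * (‖p.1 - zs‖ ^ (1 - σ) * C ^ σ))
      (nhds (zs, ls)) (nhds 0) := by
    have hσ' : 0 < 1 - σ := sub_pos.2 hσ1
    simpa [Real.zero_rpow hσ'.ne'] using
      ((hnorm.rpow_const (p := 1 - σ) (Or.inr hσ'.le)).mul_const (C ^ σ)).const_mul σ₀
  filter_upwards [hCe, hup.eventually_le_const hσ₁, hlow.eventually_le_const one_pos]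
    with p h1 h2 h3
  refine ⟨?_, h2⟩
  have he := eta_nonneg φ g p.1 p.2
  calc σ₀ * ‖p.1 - zs‖ = σ₀ * (‖p.1 - zs‖ ^ (1 - σ) * ‖p.1 - zs‖ ^ σ) := by
        rw [← Real.rpow_add_of_nonneg (norm_nonneg _) (sub_nonneg.2 hσ1.le) hσ0.le,
          sub_add_cancel, Real.rpow_one]
    _ ≤ σ₀ * (‖p.1 - zs‖ ^ (1 - σ) * (C * eta φ g p.1 p.2) ^ σ) := by gcongr
    _ = σ₀ * (‖p.1 - zs‖ ^ (1 - σ) * C ^ σ) * (eta φ g p.1 p.2) ^ σ := by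
        rw [Real.mul_rpow hC.le he]; ring
    _ ≤ 1 * (eta φ g p.1 p.2) ^ σ :=
        mul_le_mul_of_nonneg_right h3 (Real.rpow_nonneg he _)
    _ = (eta φ g p.1 p.2) ^ σ := one_mul _

lemma dist_le_pdist {n m : ℕ} (p q : En n × En m) : dist p q ≤ pdist p q := by
  rw [Prod.dist_eq, dist_eq_norm, dist_eq_norm]
  exact max_le (Real.le_sqrt_of_sq_le (le_add_of_nonneg_right (sq_nonneg _)))
    (Real.le_sqrt_of_sq_le (le_add_of_nonneg_left (sq_nonneg _)))

/-- Lemma 5.1: the choice μ_k = η(z^k,λ^k)^σ eventually satisfies the requirement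
μ_k ∈ [σ₀‖z^k − z*‖, σ₁] of Corollary 5.1, so its conclusions hold for this choice. -/
theorem stmt_9 {n m : ℕ} (φ : En n → ℝ) (g : Fin m → En n → ℝ) (zs : En n)
    (hA : AssumpA φ g zs) (ls : En m) (hls : ls ∈ Slam φ g zs)
    (hpos : ∀ i ∈ Bplus φ g zs, 0 < ls i)
    -- σ₀, ρ₀, σ₁, γ, β̄ are the constants from Corollary 5.1:
    (σ₀ ρ₀ σ₁ γ βb : ℝ)
    (hσ₀ : 0 < σ₀) (hρ₀ : 0 < ρ₀) (hσ₁ : 0 < σ₁) (hγ : 1 ≤ γ) (hβb : 0 < βb)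
    (hρσ : σ₀ * ρ₀ < σ₁)
    (hgen : ∀ (z0 : En n) (l0 : En m), pdist (z0, l0) (zs, ls) ≤ ρ₀ →
      ∀ μsel : En n × En m → ℝ,
        (∀ p : En n × En m, σ₀ * ‖p.1 - zs‖ ≤ μsel p ∧ μsel p ≤ σ₁) →
        ∃ Z : ℕ → En n × En m, Z 0 = (z0, l0) ∧
          ∀ k, ∃ (dz : En n) (lp : En m),
            SSQPSol φ g (Z k).1 (Z k).2 (μsel (Z k)) dz lp ∧
            Z (k + 1) = ((Z k).1 + dz, lp) ∧
            pdist (Z (k + 1)) (zs, ls) ≤ γ * pdist (z0, l0) (zs, ls))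
    (hest : ∀ (z0 : En n) (l0 : En m), pdist (z0, l0) (zs, ls) ≤ ρ₀ →
      ∀ (Z : ℕ → En n × En m) (μ : ℕ → ℝ), Z 0 = (z0, l0) →
        (∀ k, σ₀ * ‖(Z k).1 - zs‖ ≤ μ k ∧ μ k ≤ σ₁ ∧
          ∃ (dz : En n) (lp : En m),
            SSQPSol φ g (Z k).1 (Z k).2 (μ k) dz lp ∧
            Z (k + 1) = ((Z k).1 + dz, lp) ∧
            pdist (Z (k + 1)) (zs, ls) ≤ γ * pdist (z0, l0) (zs, ls)) →
        ∀ k, deltaP φ g zs (Z (k + 1)).1 (Z (k + 1)).2 ≤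
          βb * ((deltaP φ g zs (Z k).1 (Z k).2) ^ 2 +
                μ k * Metric.infDist (Z k).2 (Slam φ g zs)))
    (σ : ℝ) (hσ0 : 0 < σ) (hσ1 : σ < 1) :
    ∃ ρ₂ : ℝ, 0 < ρ₂ ∧ ρ₂ ≤ ρ₀ ∧
      ∀ (z0 : En n) (l0 : En m), pdist (z0, l0) (zs, ls) ≤ ρ₂ →
        ∀ Z : ℕ → En n × En m, Z 0 = (z0, l0) →
          (∀ k, ∃ (dz : En n) (lp : En m),
            SSQPSol φ g (Z k).1 (Z k).2 ((eta φ g (Z k).1 (Z k).2) ^ σ) dz lp ∧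
            Z (k + 1) = ((Z k).1 + dz, lp) ∧
            pdist (Z (k + 1)) (zs, ls) ≤ γ * pdist (z0, l0) (zs, ls)) →
          ∀ k, σ₀ * ‖(Z k).1 - zs‖ ≤ (eta φ g (Z k).1 (Z k).2) ^ σ ∧
               (eta φ g (Z k).1 (Z k).2) ^ σ ≤ σ₁ := by
  obtain ⟨hφ, hg⟩ := hA.1.contDiffAt
  obtain ⟨ε, hε, hball⟩ := Metric.eventually_nhds_iff.1
    (eventually_eta_rpow_bounds hφ hg hA.2.2.2 hls hpos hσ₀ hσ₁ hσ0 hσ1)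
  have hγ0 : 0 < γ := one_pos.trans_le hγ
  refine ⟨min ρ₀ (ε / (2 * γ)), lt_min hρ₀ (by positivity), min_le_left _ _, ?_⟩
  intro z0 l0 h0 Z hZ0 hZ k
  have hsmall : γ * pdist (z0, l0) (zs, ls) < ε := by
    have h1 := (le_div_iff₀ (by positivity)).1 (h0.trans (min_le_right _ _))
    linarith
  refine hball (y := Z k) ((dist_le_pdist _ _).trans_lt ?_)
  cases k with
  | zero =>
    rw [hZ0]
    exact (le_mul_of_one_le_left (Real.sqrt_nonneg _) hγ).trans_lt hsmall
  | succ k =>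
    obtain ⟨dz, lp, -, -, hle⟩ := hZ k
    exact hle.trans_lt hsmall
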